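/- Let G be a discrete group with FC(G) finite, and let T be a transversal for FC(G) in G. The weak*-closed two-sided ideals of ℓ¹(G) are exactly the sets ⊕_{t∈T} δ_t * K(Ω) = {f ∈ ℓ¹(G) : the restriction of δ_{t⁻¹} * f to FC(G) belongs to K(Ω) for every t ∈ T}, where Ω ranges over the subsets of the unitary dual of FC(G) that are unions of orbits for the action of G on that dual induced by conjugation. -/

import Mathlib

noncomputable section

open Filter Topology
open scoped Classical ENNReal

/-- Membership in `ℓ¹(G)`: absolutely summable complex-valued functions on `G`. -/
def MemL1 {G : Type*} (f : G → ℂ) : Prop := Summable fun t => ‖f t‖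

/-- Convolution of two functions on a group. -/
def convFn {G : Type*} [Group G] (f g : G → ℂ) : G → ℂ := fun x => ∑' s : G, f s * g (s⁻¹ * x)

/-- `ℓ¹(G)` as a type. -/
def L1 (G : Type*) : Type _ := {f : G → ℂ // MemL1 f}

/-- The predicate of belonging to `c₀(G)`: functions vanishing at infinity on the
discrete group `G`. -/
def MemC0 {G : Type*} (φ : G → ℂ) : Prop := Tendsto φ cofinite (𝓝 0)

/-- The weak*-topology `σ(ℓ¹(G), c₀(G))` on `ℓ¹(G)`, induced by the pairings
`f ↦ Σ_{t∈G} φ(t) f(t)` with `φ ∈ c₀(G)`. -/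
instance L1.topology (G : Type*) : TopologicalSpace (L1 G) :=
  TopologicalSpace.induced
    (fun f : L1 G => fun φ : {φ : G → ℂ // MemC0 φ} => ∑' t : G, φ.1 t * f.1 t)
    inferInstance

/-- A set of elements of `ℓ¹(G)` is weak*-closed. -/
def WStarClosed {G : Type*} (S : Set (G → ℂ)) : Prop := IsClosed {f : L1 G | f.1 ∈ S}

/-- A weak*-closed two-sided ideal of the convolution algebra `ℓ¹(G)`. -/
def IsWStarClosedIdeal {G : Type*} [Group G] (S : Set (G → ℂ)) : Prop :=
  S ⊆ {f | MemL1 f} ∧ (0 : G → ℂ) ∈ S ∧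
  (∀ f ∈ S, ∀ g ∈ S, f + g ∈ S) ∧
  (∀ (c : ℂ), ∀ f ∈ S, c • f ∈ S) ∧
  (∀ f ∈ S, ∀ g : G → ℂ, MemL1 g → convFn g f ∈ S ∧ convFn f g ∈ S) ∧
  WStarClosed S

/-- The point mass `δ_t ∈ ℓ¹(G)`. -/
def delta {G : Type*} (t : G) : G → ℂ := fun x => if x = t then 1 else 0

/-- `f` is supported in the subset `N` of `G`. -/
def SuppIn {G : Type*} (N : Set G) (f : G → ℂ) : Prop := ∀ x, x ∉ N → f x = 0

/-- `ℓ¹(N)`, identified with the subalgebra of `ℓ¹(G)` of functions supported on `N`. -/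
def L1On {G : Type*} (N : Set G) : Set (G → ℂ) := {f | MemL1 f ∧ SuppIn N f}

/-- A two-sided ideal of `ℓ¹(N)` (identified with the functions in `ℓ¹(G)` supported
on `N`). -/
def IsIdealOn {G : Type*} [Group G] (N : Set G) (J : Set (G → ℂ)) : Prop :=
  J ⊆ L1On N ∧ (0 : G → ℂ) ∈ J ∧
  (∀ f ∈ J, ∀ g ∈ J, f + g ∈ J) ∧
  (∀ (c : ℂ), ∀ f ∈ J, c • f ∈ J) ∧
  (∀ f ∈ J, ∀ g ∈ L1On N, convFn g f ∈ J ∧ convFn f g ∈ J)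

/-- The conjugate `f^s = δ_s * f * δ_{s⁻¹}` of `f ∈ ℓ¹(G)` by `s ∈ G`,
so that `f^s (g) = f (s⁻¹ g s)`. -/
def conjFn {G : Type*} [Group G] (s : G) (f : G → ℂ) : G → ℂ := fun g => f (s⁻¹ * g * s)

/-- `J` is invariant under conjugation by elements of `G`:
`δ_s * J * δ_{s⁻¹} = J` for all `s ∈ G`. -/
def GConjInvariant {G : Type*} [Group G] (J : Set (G → ℂ)) : Prop :=
  ∀ s : G, conjFn s '' J = J

/-- `T` is a transversal (set of coset representatives) for `N` in `G`. -/
def IsTransversal {G : Type*} [Group G] (N : Set G) (T : Set G) : Prop :=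
  ∀ g : G, ∃! t : G, t ∈ T ∧ t⁻¹ * g ∈ N

/-- The set `⊕_{t ∈ T} δ_t * J`: those `f ∈ ℓ¹(G)` such that for every `t ∈ T` the
restriction of `δ_{t⁻¹} * f` to `N` belongs to `J`. -/
def bigOplus {G : Type*} [Group G] (N T : Set G) (J : Set (G → ℂ)) : Set (G → ℂ) :=
  {f | MemL1 f ∧ ∀ t ∈ T, N.indicator (convFn (delta t⁻¹) f) ∈ J}

/-- The FC-centre of `G`: the set of elements with finite conjugacy class. -/
def FCset (G : Type*) [Group G] : Set G := {t : G | {x : G | IsConj t x}.Finite}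

/-- The FC-centre of `G` as a subgroup. -/
def FC (G : Type*) [Group G] : Subgroup G where
  carrier := {t : G | {x : G | IsConj t x}.Finite}
  one_mem' := by
    refine Set.Finite.subset (Set.finite_singleton 1) ?_
    intro x hx
    simpa using isConj_one_right.mp hx
  mul_mem' := by
    intro a b ha hb
    refine Set.Finite.subset (Set.Finite.image2 (· * ·) ha hb) ?_
    intro x hx
    obtain ⟨c, hc⟩ := isConj_iff.mp hx
    exact ⟨c * a * c⁻¹, isConj_iff.mpr ⟨c, rfl⟩, c * b * c⁻¹, isConj_iff.mpr ⟨c, rfl⟩,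
      by rw [← hc]; group⟩
  inv_mem' := by
    intro a ha
    refine Set.Finite.subset (ha.image Inv.inv) ?_
    intro x hx
    obtain ⟨c, hc⟩ := isConj_iff.mp hx
    exact ⟨(c * a * c⁻¹ : _), isConj_iff.mpr ⟨c, rfl⟩, by rw [← hc]; group⟩

instance FC_normal (G : Type*) [Group G] : (FC G).Normal := by
  constructor
  intro n hn g
  have h : {x : G | IsConj (g * n * g⁻¹) x} = {x : G | IsConj n x} := by
    ext x
    have hconj : IsConj n (g * n * g⁻¹) := isConj_iff.mpr ⟨g, rfl⟩
    exact ⟨fun hx => hconj.trans hx, fun hx => hconj.symm.trans hx⟩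
  show {x : G | IsConj (g * n * g⁻¹) x}.Finite
  rw [h]
  exact hn

/-- An irreducible unitary representation of the group `N` (realised concretely by
unitary matrices). -/
structure IrrRep (N : Type*) [Group N] where
  /-- the (positive, finite) dimension -/
  dim : ℕ
  dimPos : 0 < dim
  /-- the representation, by unitary matrices -/
  ρ : N →* Matrix.unitaryGroup (Fin dim) ℂ
  /-- irreducibility: the only invariant subspaces are `⊥` and `⊤` -/
  irred : ∀ W : Submodule ℂ (Fin dim → ℂ),
    (∀ n : N, ∀ v ∈ W, Matrix.mulVec ((ρ n : Matrix (Fin dim) (Fin dim) ℂ)) v ∈ W) →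
    W = ⊥ ∨ W = ⊤

/-- The action of `G` on the unitary dual of `FC(G)` induced by conjugation:
`(t · π)(n) = π (t⁻¹ n t)`. -/
def conjRep {G : Type*} [Group G] (t : G) (π : IrrRep (FC G)) : IrrRep (FC G) where
  dim := π.dim
  dimPos := π.dimPos
  ρ := π.ρ.comp (MulAut.conjNormal (G := G) t⁻¹).toMonoidHom
  irred := fun W hW => π.irred W (fun n v hv => by
    have h := hW ((MulAut.conjNormal (G := G) t⁻¹).symm n) v hv
    simpa using h)

/-- `K(Ω) = ⋂_{π ∈ Ω} ker π`, as an ideal of `ℓ¹(FC(G))` (identified with the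
functions in `ℓ¹(G)` supported on `FC(G)`). -/
def KSet {G : Type*} [Group G] (Ω : Set (IrrRep (FC G))) : Set (G → ℂ) :=
  {f | f ∈ L1On (FC G : Set G) ∧ ∀ π ∈ Ω,
    ∑ᶠ n : (FC G : Subgroup G), f (n : G) •
      ((π.ρ n : Matrix (Fin π.dim) (Fin π.dim) ℂ)) = 0}

open scoped InnerProductSpace in
/-- An irreducible finite-dimensional representation which preserves an inner product is
given by unitary matrices. -/
lemma exists_irrRep_of_irreducible {H : Type*} [Group H] [Fintype H] {V : Type*}
    [NormedAddCommGroup V] [InnerProductSpace ℂ V] [FiniteDimensional ℂ V] [Nontrivial V]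
    (σ : Representation ℂ H V) (hσ : ∀ n v w, ⟪σ n v, σ n w⟫_ℂ = ⟪v, w⟫_ℂ)
    (hirr : ∀ W : Submodule ℂ V, (∀ n, ∀ v ∈ W, σ n v ∈ W) → W = ⊥ ∨ W = ⊤) :
    ∃ π : IrrRep H, ∀ x : H → ℂ,
      ∑ n, x n • (π.ρ n : Matrix (Fin π.dim) (Fin π.dim) ℂ) = 0 ↔ ∑ n, x n • σ n = 0 := by
  let b := stdOrthonormalBasis ℂ V
  let M : H → Matrix _ _ ℂ := fun n => LinearMap.toMatrix b.toBasis b.toBasis (σ n)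
  have hMmul (m n : H) : M (m * n) = M m * M n := by
    simp only [M, map_mul, LinearMap.toMatrix_mul]
  have hMone : M 1 = 1 := by simp only [M, map_one, LinearMap.toMatrix_one]
  have hMstar (n : H) : star (M n) = M n⁻¹ := by
    ext i j
    simp only [M, Matrix.star_apply, LinearMap.toMatrix_apply, OrthonormalBasis.coe_toBasis,
      OrthonormalBasis.coe_toBasis_repr_apply, OrthonormalBasis.repr_apply_apply, RCLike.star_def,
      inner_conj_symm]
    rw [← hσ n (b i), ← Module.End.mul_apply, ← map_mul, mul_inv_cancel, map_one,
      Module.End.one_apply]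
  let ρ : H →* Matrix.unitaryGroup (Fin (Module.finrank ℂ V)) ℂ :=
    { toFun n := ⟨M n, Matrix.mem_unitaryGroup_iff.mpr (by
        rw [hMstar, ← hMmul, mul_inv_cancel, hMone])⟩
      map_one' := Subtype.ext hMone
      map_mul' m n := Subtype.ext (hMmul m n) }
  refine ⟨⟨_, Module.finrank_pos, ρ, fun W hW => ?_⟩, fun x => ?_⟩
  · let e := b.toBasis.equivFun
    have he (n : H) (v : V) : e (σ n v) = (M n).mulVec (e v) :=
      (LinearMap.toMatrix_mulVec_repr b.toBasis b.toBasis (σ n) v).symm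
    have hcomap := hirr (W.comap e.toLinearMap) fun n v hv => by
      rw [Submodule.mem_comap, LinearEquiv.coe_coe, he]
      exact hW n _ hv
    have hmap : (W.comap e.toLinearMap).map e.toLinearMap = W :=
      Submodule.map_comap_eq_of_surjective e.surjective W
    rcases hcomap with h | h
    · left; rw [← hmap, h, Submodule.map_bot]
    · right; rw [← hmap, h, Submodule.map_top]; exact e.range
  · change ∑ n, x n • M n = 0 ↔ _
    have : ∑ n, x n • M n = LinearMap.toMatrix b.toBasis b.toBasis (∑ n, x n • σ n) := by
      simp [M, map_sum]
    rw [this, LinearEquiv.map_eq_zero_iff]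

open scoped InnerProductSpace in
/-- If `x` is annihilated by all irreducible representations which annihilate `J`, then it is
annihilated by all unitary representations which annihilate `J`. -/
lemma sum_smul_apply_eq_zero_of_irrRep {H : Type*} [Group H] [Fintype H] (J : Set (H → ℂ))
    (x : H → ℂ)
    (hx : ∀ π : IrrRep H,
      (∀ j ∈ J, ∑ n, j n • (π.ρ n : Matrix (Fin π.dim) (Fin π.dim) ℂ) = 0) →
        ∑ n, x n • (π.ρ n : Matrix (Fin π.dim) (Fin π.dim) ℂ) = 0)
    (d : ℕ) {V : Type*}
    [NormedAddCommGroup V] [InnerProductSpace ℂ V] [FiniteDimensional ℂ V]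
    (hd : Module.finrank ℂ V = d)
    (σ : Representation ℂ H V) (hσ : ∀ n v w, ⟪σ n v, σ n w⟫_ℂ = ⟪v, w⟫_ℂ)
    (hJ : ∀ j ∈ J, ∀ v, ∑ n, j n • σ n v = 0) (v : V) :
    ∑ n, x n • σ n v = 0 := by
  induction d using Nat.strong_induction_on generalizing V with
  | _ d ih =>
  by_cases hirr : ∀ W : Submodule ℂ V, (∀ n, ∀ v ∈ W, σ n v ∈ W) → W = ⊥ ∨ W = ⊤
  · rcases subsingleton_or_nontrivial V with _ | _
    · exact Subsingleton.elim _ _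
    · obtain ⟨π, hπ⟩ := exists_irrRep_of_irreducible σ hσ hirr
      have := (hπ x).mp (hx π fun j hj => (hπ j).mpr (LinearMap.ext fun w => by
        simpa using hJ j hj w))
      simpa using congrArg (fun f => f v) this
  · push Not at hirr
    obtain ⟨W, hW, hbot, htop⟩ := hirr
    have restrict (U : Submodule ℂ V) (hU : ∀ n, ∀ v ∈ U, σ n v ∈ U) (hUtop : U ≠ ⊤) (u : V)
        (hu : u ∈ U) : ∑ n, x n • σ n u = 0 := by
      let τ : Representation ℂ H U :=
        Subrepresentation.toRepresentation (ρ := σ) ⟨U, fun n _ h => hU n _ h⟩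
      have hτ (n : H) (w : U) : (τ n w : V) = σ n w := rfl
      have := ih _ (hd ▸ Submodule.finrank_lt hUtop) rfl τ
        (fun n v w => by simp only [Submodule.coe_inner, hτ, hσ])
        (fun j hj w => Subtype.ext (by simpa [hτ] using hJ j hj w)) ⟨u, hu⟩
      simpa [hτ] using congrArg Subtype.val this
    have hperp (n : H) (u : V) (hu : u ∈ Wᗮ) : σ n u ∈ Wᗮ := by
      rw [Submodule.mem_orthogonal] at hu ⊢
      intro w hw
      have := hu _ (hW n⁻¹ w hw)
      rwa [← hσ n, ← Module.End.mul_apply, ← map_mul, mul_inv_cancel, map_one,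
        Module.End.one_apply] at this
    obtain ⟨y, hy, z, hz, rfl⟩ := W.exists_add_mem_mem_orthogonal v
    have hperp_top : Wᗮ ≠ ⊤ := by rwa [Ne, Submodule.orthogonal_eq_top_iff]
    simp [smul_add, Finset.sum_add_distrib, restrict W hW htop y hy,
      restrict Wᗮ hperp hperp_top z hz]

/-- The left regular representation on the Hilbert space of functions on a finite group. -/
def leftRegular (H : Type*) [Group H] [Fintype H] : Representation ℂ H (EuclideanSpace ℂ H) where
  toFun n :=
    { toFun v := WithLp.toLp 2 fun m => v (n⁻¹ * m)
      map_add' _ _ := rfl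
      map_smul' _ _ := rfl }
  map_one' := by ext; simp
  map_mul' m n := LinearMap.ext fun v => PiLp.ext fun k =>
    congrArg v.ofLp (show (m * n)⁻¹ * k = n⁻¹ * (m⁻¹ * k) by group)

/-- A two-sided ideal of the group algebra of a finite group contains every element that is
annihilated by all irreducible representations annihilating the ideal. -/
lemma mem_of_forall_irrRep {H : Type*} [Group H] [Fintype H] (J : Submodule ℂ (H → ℂ))
    (hleft : ∀ n, ∀ j ∈ J, (fun m => j (n * m)) ∈ J)
    (hright : ∀ n, ∀ j ∈ J, (fun m => j (m * n)) ∈ J) (x : H → ℂ)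
    (hx : ∀ π : IrrRep H,
      (∀ j ∈ J, ∑ n, j n • (π.ρ n : Matrix (Fin π.dim) (Fin π.dim) ℂ) = 0) →
        ∑ n, x n • (π.ρ n : Matrix (Fin π.dim) (Fin π.dim) ℂ) = 0) :
    x ∈ J := by
  let σ := leftRegular H
  have hσ_apply (n : H) (v : EuclideanSpace ℂ H) (m : H) : σ n v m = v (n⁻¹ * m) := rfl
  have hσ (n : H) (v w : EuclideanSpace ℂ H) : inner ℂ (σ n v) (σ n w) = inner ℂ v w := by
    simp only [PiLp.inner_apply, hσ_apply]
    exact Equiv.sum_comp (Equiv.mulLeft n⁻¹) fun m => inner ℂ (v m) (w m)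
  let E : Submodule ℂ (EuclideanSpace ℂ H) :=
    J.comap (WithLp.linearEquiv 2 ℂ (H → ℂ)).toLinearMap
  have hE (v : EuclideanSpace ℂ H) : v ∈ E ↔ (fun m => v m) ∈ J := Iff.rfl
  have hEleft (n : H) (v : EuclideanSpace ℂ H) (hv : v ∈ E) : σ n v ∈ E := hleft n⁻¹ _ hv
  have hperp (n : H) (u : EuclideanSpace ℂ H) (hu : u ∈ Eᗮ) : σ n u ∈ Eᗮ := by
    rw [Submodule.mem_orthogonal] at hu ⊢
    intro w hw
    have := hu _ (hEleft n⁻¹ w hw)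
    rwa [← hσ n, ← Module.End.mul_apply, ← map_mul, mul_inv_cancel, map_one,
      Module.End.one_apply] at this
  have hconv (j : H → ℂ) (hj : j ∈ J) (v : EuclideanSpace ℂ H) : ∑ n, j n • σ n v ∈ E := by
    have : (fun m => (∑ n, j n • σ n v) m) = ∑ n, v n • fun m => j (m * n⁻¹) := by
      ext m
      simp only [WithLp.ofLp_sum, WithLp.ofLp_smul, Finset.sum_apply, Pi.smul_apply, hσ_apply,
        smul_eq_mul]
      refine Fintype.sum_equiv ((Equiv.inv H).trans (Equiv.mulRight m)) _ _ fun n => ?_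
      simp [mul_comm]
    rw [hE, this]
    exact Submodule.sum_mem _ fun n _ => J.smul_mem _ (hright n⁻¹ j hj)
  let τ : Representation ℂ H ↥(Eᗮ) :=
    Subrepresentation.toRepresentation (ρ := σ) ⟨Eᗮ, fun n _ h => hperp n _ h⟩
  have hτ (n : H) (w : ↥(Eᗮ)) : (τ n w : EuclideanSpace ℂ H) = σ n w := rfl
  have hzero := sum_smul_apply_eq_zero_of_irrRep (J : Set (H → ℂ)) x hx _ rfl τ
    (fun n v w => by simp only [Submodule.coe_inner, hτ, hσ])
    (fun j hj w => by
      have hmem : ((∑ n, j n • τ n w : ↥(Eᗮ)) : EuclideanSpace ℂ H) ∈ E := by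
        simpa [hτ] using hconv j hj w
      exact Subtype.ext (Submodule.disjoint_def.mp E.orthogonal_disjoint _ hmem
        (Subtype.property _)))
  obtain ⟨y, hy, z, hz, hyz⟩ := E.exists_add_mem_mem_orthogonal (EuclideanSpace.single 1 1)
  have hxz : ∑ n, x n • σ n z = 0 := by
    simpa [hτ] using congrArg Subtype.val (hzero ⟨z, hz⟩)
  have hxy : ∑ n, x n • σ n y ∈ E :=
    Submodule.sum_mem _ fun n _ => E.smul_mem _ (hEleft n y hy)
  have hxx : ∑ n, x n • σ n (EuclideanSpace.single 1 1) ∈ E := by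
    simpa [hyz, smul_add, Finset.sum_add_distrib, hxz] using hxy
  rw [hE] at hxx
  convert hxx using 1
  ext m
  simp [hσ_apply, inv_mul_eq_one]

section L1Lemmas

variable {G : Type*}

lemma MemL1.summable {f : G → ℂ} (hf : MemL1 f) : Summable f := Summable.of_norm hf

lemma MemL1.indicator {f : G → ℂ} (hf : MemL1 f) (s : Set G) : MemL1 (s.indicator f) :=
  Summable.of_nonneg_of_le (fun _ => norm_nonneg _) (fun _ => norm_indicator_le_norm_self f _) hf

lemma MemL1.add {f g : G → ℂ} (hf : MemL1 f) (hg : MemL1 g) : MemL1 (f + g) :=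
  Summable.of_nonneg_of_le (fun _ => norm_nonneg _) (fun _ => norm_add_le _ _)
    (Summable.add hf hg)

lemma MemL1.smul {f : G → ℂ} (c : ℂ) (hf : MemL1 f) : MemL1 (c • f) := by
  simpa [MemL1] using Summable.mul_left ‖c‖ hf

lemma memL1_of_finite_support {f : G → ℂ} {s : Set G} (hs : s.Finite) (hf : SuppIn s f) :
    MemL1 f :=
  summable_of_hasFiniteSupport (hs.subset fun x hx => by
    contrapose! hx
    simp [hf x hx])

lemma memL1_delta (t : G) : MemL1 (delta t) :=
  memL1_of_finite_support (Set.finite_singleton t) fun _ hx => if_neg hx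

lemma MemC0.exists_norm_le {φ : G → ℂ} (hφ : MemC0 φ) : ∃ C, ∀ t, ‖φ t‖ ≤ C := by
  obtain ⟨C, hC⟩ := (Tendsto.norm hφ).bddAbove_range_of_cofinite
  exact ⟨C, fun t => hC ⟨t, rfl⟩⟩

lemma memC0_delta (t : G) : MemC0 (delta t) := by
  refine tendsto_const_nhds.congr' ?_
  filter_upwards [(Set.finite_singleton t).compl_mem_cofinite] with x hx
  exact (if_neg hx).symm

lemma tsum_delta_mul (t : G) (f : G → ℂ) : ∑' x, delta t x * f x = f t := by
  rw [tsum_eq_single t fun x hx => by simp [delta, hx]]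
  simp [delta]

/-- Evaluation at a point is weak*-continuous. -/
lemma continuous_eval_L1 (t : G) : Continuous fun f : L1 G => f.1 t := by
  have h : Continuous fun f : L1 G => fun φ : {φ : G → ℂ // MemC0 φ} => ∑' t : G, φ.1 t * f.1 t :=
    continuous_induced_dom
  convert (continuous_apply ⟨delta t, memC0_delta t⟩).comp h using 1
  exact funext fun f => (tsum_delta_mul t f.1).symm

lemma WStarClosed.mem_of_tendsto {S : Set (G → ℂ)} (hS : WStarClosed S) (hSL : S ⊆ {f | MemL1 f})
    {ι : Type*} {l : Filter ι} [l.NeBot] {u : ι → G → ℂ} (hu : ∀ i, u i ∈ S)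
    {f : G → ℂ} (hf : MemL1 f)
    (h : ∀ φ : G → ℂ, MemC0 φ →
      Tendsto (fun i => ∑' t, φ t * u i t) l (𝓝 (∑' t, φ t * f t))) :
    f ∈ S := by
  let v : ι → L1 G := fun i => ⟨u i, hSL (hu i)⟩
  let a : L1 G := ⟨f, hf⟩
  have hv : Tendsto v l (𝓝 a) := by
    rw [nhds_induced, tendsto_comap_iff, tendsto_pi_nhds]
    exact fun φ => h φ.1 φ.2
  have hclosed : IsClosed {f : L1 G | f.1 ∈ S} := hS
  exact hclosed.mem_of_tendsto hv (Eventually.of_forall hu)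

lemma MemL1.bounded_mul {f g : G → ℂ} (hg : MemL1 g) {C : ℝ} (hf : ∀ t, ‖f t‖ ≤ C) :
    Summable fun t => f t * g t :=
  Summable.of_norm_bounded (Summable.mul_left C hg) fun t => by
    rw [norm_mul]; exact mul_le_mul_of_nonneg_right (hf t) (norm_nonneg _)

lemma MemL1.exists_norm_le {f : G → ℂ} (hf : MemL1 f) : ∃ C, ∀ t, ‖f t‖ ≤ C :=
  MemC0.exists_norm_le (Summable.tendsto_cofinite_zero hf.summable)

variable [Group G]

lemma convFn_delta_left (t : G) (f : G → ℂ) : convFn (delta t) f = fun x => f (t⁻¹ * x) :=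
  funext fun x => tsum_delta_mul t fun s => f (s⁻¹ * x)

/-- Convolution, summed over the second factor. -/
lemma convFn_eq_tsum (f g : G → ℂ) (x : G) : convFn f g x = ∑' u, f (x * u⁻¹) * g u := by
  rw [convFn, ← ((Equiv.inv G).trans (Equiv.mulLeft x)).tsum_eq]
  simp

lemma convFn_delta_right (t : G) (f : G → ℂ) : convFn f (delta t) = fun x => f (x * t⁻¹) := by
  funext x
  simp_rw [convFn_eq_tsum, mul_comm (f _)]
  exact tsum_delta_mul t fun u => f (x * u⁻¹)

lemma summable_mul_convFn {f g : G → ℂ} (hf : MemL1 f) (hg : MemL1 g) :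
    Summable fun p : G × G => ‖f p.2 * g (p.2⁻¹ * p.1)‖ := by
  let e : G × G ≃ G × G :=
    { toFun p := (p.2, p.2⁻¹ * p.1)
      invFun q := (q.1 * q.2, q.1)
      left_inv p := by simp
      right_inv q := by simp }
  exact e.summable_iff.mpr (Summable.mul_norm hf hg)

lemma MemL1.convFn {f g : G → ℂ} (hf : MemL1 f) (hg : MemL1 g) : MemL1 (convFn f g) := by
  have h := summable_mul_convFn hf hg
  exact Summable.of_nonneg_of_le (fun _ => norm_nonneg _)
    (fun x => norm_tsum_le_tsum_norm (h.prod_factor x)) h.prod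

lemma MemL1.comp_mul_left {f : G → ℂ} (hf : MemL1 f) (t : G) : MemL1 fun x => f (t * x) :=
  (Equiv.mulLeft t).summable_iff.mpr hf

end L1Lemmas

section Annihilator

variable {G : Type*} [Group G] [Fintype (FC G)]

/-- The members of `⊕ δ_t * K(Ω)` are the functions whose left translates are all annihilated,
after restriction to the FC-centre, by every representation in `Ω`. -/
lemma mem_bigOplus_KSet_iff {T : Set G} (hT : IsTransversal (FC G : Set G) T)
    (Ω : Set (IrrRep (FC G))) (f : G → ℂ) :
    f ∈ bigOplus (FC G : Set G) T (KSet Ω) ↔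
      MemL1 f ∧ ∀ π ∈ Ω, ∀ g : G,
        ∑ n : FC G, f (g * n) • (π.ρ n : Matrix (Fin π.dim) (Fin π.dim) ℂ) = 0 := by
  have key (t : G) (π : IrrRep (FC G)) :
      ∑ᶠ n : FC G, (FC G : Set G).indicator (convFn (delta t⁻¹) f) (n : G) •
        (π.ρ n : Matrix (Fin π.dim) (Fin π.dim) ℂ) =
      ∑ n : FC G, f (t * n) • (π.ρ n : Matrix (Fin π.dim) (Fin π.dim) ℂ) := by
    rw [finsum_eq_sum_of_fintype]
    refine Finset.sum_congr rfl fun n _ => ?_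
    rw [Set.indicator_of_mem n.2, convFn_delta_left, inv_inv]
  refine and_congr_right fun hf => ⟨fun h π hπ g => ?_, fun h t _ => ⟨⟨?_, ?_⟩, fun π hπ => ?_⟩⟩
  · obtain ⟨t, ⟨ht, hmem⟩, -⟩ := hT g
    let m : FC G := ⟨t⁻¹ * g, hmem⟩
    have hzero := (key t π).symm.trans ((h t ht).2 π hπ)
    have hsum : ∑ n : FC G, f (g * n) • (π.ρ n : Matrix (Fin π.dim) (Fin π.dim) ℂ) =
        (π.ρ m⁻¹ : Matrix (Fin π.dim) (Fin π.dim) ℂ) *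
          ∑ n : FC G, f (t * n) • (π.ρ n : Matrix (Fin π.dim) (Fin π.dim) ℂ) := by
      rw [Finset.mul_sum]
      refine Fintype.sum_equiv (Equiv.mulLeft m) _ _ fun n => ?_
      rw [Matrix.mul_smul, ← Submonoid.coe_mul, ← map_mul]
      simp [m, mul_assoc]
    rw [hsum, hzero, mul_zero]
  · rw [convFn_delta_left]
    exact (hf.comp_mul_left _).indicator _
  · exact fun x hx => Set.indicator_of_notMem hx _
  · rw [key, h π hπ]

lemma isWStarClosedIdeal_bigOplus {T : Set G} (hT : IsTransversal (FC G : Set G) T)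
    {Ω : Set (IrrRep (FC G))} (hΩ : ∀ π ∈ Ω, ∀ t : G, conjRep t π ∈ Ω) :
    IsWStarClosedIdeal (bigOplus (FC G : Set G) T (KSet Ω)) := by
  have entry {f : G → ℂ} : (∀ π ∈ Ω, ∀ g : G,
      ∑ n : FC G, f (g * n) • (π.ρ n : Matrix (Fin π.dim) (Fin π.dim) ℂ) = 0) ↔
      ∀ π ∈ Ω, ∀ g : G, ∀ i j,
        ∑ n : FC G, f (g * n) * (π.ρ n : Matrix (Fin π.dim) (Fin π.dim) ℂ) i j = 0 := by
    simp only [← Matrix.ext_iff, Matrix.sum_apply, Matrix.smul_apply, smul_eq_mul,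
      Matrix.zero_apply]
  simp only [IsWStarClosedIdeal, WStarClosed, mem_bigOplus_KSet_iff hT]
  refine ⟨fun f hf => hf.1, ⟨by simp [MemL1], by simp⟩, ?_, ?_, ?_, ?_⟩
  · rintro f ⟨hf, hfΩ⟩ g ⟨hg, hgΩ⟩
    exact ⟨hf.add hg, fun π hπ x => by
      simp [add_smul, Finset.sum_add_distrib, hfΩ π hπ, hgΩ π hπ]⟩
  · rintro c f ⟨hf, hfΩ⟩
    exact ⟨hf.smul c, fun π hπ x => by simp [mul_smul, ← Finset.smul_sum, hfΩ π hπ]⟩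
  · rintro f ⟨hf, hfΩ⟩ h hh
    refine ⟨⟨hh.convFn hf, ?_⟩, ⟨hf.convFn hh, ?_⟩⟩
    · rw [entry] at hfΩ ⊢
      intro π hπ g i j
      obtain ⟨C, hC⟩ := hf.exists_norm_le
      have hs (n : FC G) : Summable fun s => h s * f (s⁻¹ * (g * n)) := by
        simpa only [mul_comm] using MemL1.bounded_mul (f := fun s => f (s⁻¹ * (g * n))) hh
          fun _ => hC _
      simp only [convFn, ← tsum_mul_right]
      rw [← Summable.tsum_finsetSum fun n _ => (hs n).mul_right _]
      refine (tsum_congr fun s => ?_).trans tsum_zero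
      simp only [mul_assoc, ← Finset.mul_sum]
      simpa only [mul_assoc, mul_zero] using congrArg (h s * ·) (hfΩ π hπ (s⁻¹ * g) i j)
    · rw [entry] at hfΩ ⊢
      intro π hπ g i j
      obtain ⟨C, hC⟩ := hf.exists_norm_le
      have hs (n : FC G) : Summable fun u => f (g * n * u⁻¹) * h u :=
        MemL1.bounded_mul hh fun _ => hC _
      simp only [convFn_eq_tsum, ← tsum_mul_right]
      rw [← Summable.tsum_finsetSum fun n _ => (hs n).mul_right _]
      refine (tsum_congr fun u => ?_).trans tsum_zero
      simp only [mul_right_comm _ (h u), ← Finset.sum_mul]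
      rw [mul_eq_zero]
      left
      rw [← hfΩ _ (hΩ π hπ u) (g * u⁻¹) i j]
      refine Fintype.sum_equiv (MulAut.conjNormal (G := G) u).toEquiv _ _ fun n => ?_
      have hρ : (conjRep u π).ρ (MulAut.conjNormal u n) = π.ρ n :=
        congrArg π.ρ (Subtype.ext (by simp))
      change _ = _ * ((conjRep u π).ρ (MulAut.conjNormal u n)).1 i j
      rw [hρ]
      simp [mul_assoc]
  · simp only [entry, Set.ofPred_and, Set.ofPred_forall]
    refine IsClosed.inter ?_ ?_
    · convert isClosed_univ
      exact Set.eq_univ_of_forall fun f => f.2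
    · exact isClosed_iInter fun π => isClosed_iInter fun _ => isClosed_iInter fun g =>
        isClosed_iInter fun i => isClosed_iInter fun j => isClosed_eq
          (continuous_finsetSum _ fun n _ => (continuous_eval_L1 _).mul continuous_const)
          continuous_const

end Annihilator

section Ideals

variable {G : Type*} [Group G]

lemma mem_FC_of_finiteIndex_centralizer {t : G} (h : (Subgroup.centralizer {t}).FiniteIndex) :
    t ∈ FC G := by
  refine (Set.finite_range fun q : G ⧸ Subgroup.centralizer {t} =>
    q.out * t * q.out⁻¹).subset fun x hx => ?_
  obtain ⟨c, rfl⟩ := isConj_iff.mp hx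
  obtain ⟨z, hz⟩ := QuotientGroup.mk_out_eq_mul (Subgroup.centralizer {t}) c
  refine ⟨QuotientGroup.mk c, ?_⟩
  have hzt : (z : G) * t = t * z := Subgroup.mem_centralizer_singleton_iff.mp z.2
  simp only [hz]
  rw [mul_assoc c, hzt]
  group

/-- If the FC-centre is finite, there are conjugations which fix it pointwise and move the rest
of a given finite set away from that set. -/
lemma exists_conj_notMem [Finite (FC G)] (F : Finset G) :
    ∃ s : G, (∀ n ∈ FC G, s * n * s⁻¹ = n) ∧ ∀ t ∈ F, t ∉ FC G → s * t * s⁻¹ ∉ F := by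
  let C : Subgroup G := (MulAut.conjNormal : G →* MulAut (FC G)).ker
  have hC : C.FiniteIndex := Subgroup.finiteIndex_ker _
  by_contra! hcon
  replace hcon (s : G) (hs : s ∈ C) : ∃ t ∈ F, t ∉ FC G ∧ s * t * s⁻¹ ∈ F := by
    refine hcon s fun n hn => ?_
    have := congrArg (fun e : MulAut (FC G) => ((e ⟨n, hn⟩ : FC G) : G)) (MonoidHom.mem_ker.mp hs)
    simpa using this
  have : Fintype (G ⧸ C) := Subgroup.fintypeQuotientOfFiniteIndex
  let c : G → G → G := fun t e => if h : ∃ s, s * t * s⁻¹ = e then h.choose else 1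
  have hc (s t : G) : c t (s * t * s⁻¹) * t * (c t (s * t * s⁻¹))⁻¹ = s * t * s⁻¹ := by
    have h : ∃ s', s' * t * s'⁻¹ = s * t * s⁻¹ := ⟨s, rfl⟩
    simp only [c, dif_pos h]
    exact h.choose_spec
  obtain ⟨k, hk, hfin⟩ := Subgroup.exists_finiteIndex_of_leftCoset_cover
    (s := (Finset.univ : Finset (G ⧸ C)) ×ˢ (F.filter (· ∉ FC G)) ×ˢ F)
    (H := fun k => Subgroup.centralizer {k.2.1}) (g := fun k => k.1.out * c k.2.1 k.2.2) (by
      refine Set.eq_univ_of_forall fun x => ?_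
      let q : G ⧸ C := QuotientGroup.mk x
      have hq : q.out⁻¹ * x ∈ C := QuotientGroup.eq.mp (QuotientGroup.out_eq' q)
      obtain ⟨t, htF, ht, he⟩ := hcon _ hq
      refine Set.mem_biUnion (x := (q, t, q.out⁻¹ * x * t * (q.out⁻¹ * x)⁻¹))
        (by simpa using ⟨⟨htF, ht⟩, by simpa using he⟩) ?_
      rw [mem_leftCoset_iff, SetLike.mem_coe, Subgroup.mem_centralizer_singleton_iff]
      have := hc (q.out⁻¹ * x) t
      generalize c t (q.out⁻¹ * x * t * (q.out⁻¹ * x)⁻¹) = c' at this ⊢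
      calc (q.out * c')⁻¹ * x * t
          = c'⁻¹ * (q.out⁻¹ * x * t * (q.out⁻¹ * x)⁻¹) * (q.out⁻¹ * x) := by group
        _ = t * ((q.out * c')⁻¹ * x) := by rw [← this]; group)
  simp only [Finset.mem_product, Finset.mem_filter] at hk
  exact hk.2.1.2 (mem_FC_of_finiteIndex_centralizer hfin)

variable {I : Set (G → ℂ)}

lemma IsWStarClosedIdeal.comp_mul_left_mem (hI : IsWStarClosedIdeal I) {f : G → ℂ} (hf : f ∈ I)
    (t : G) : (fun x => f (t * x)) ∈ I := by
  have := (hI.2.2.2.2.1 f hf _ (memL1_delta t⁻¹)).1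
  rwa [convFn_delta_left, inv_inv] at this

lemma IsWStarClosedIdeal.comp_mul_right_mem (hI : IsWStarClosedIdeal I) {f : G → ℂ} (hf : f ∈ I)
    (t : G) : (fun x => f (x * t)) ∈ I := by
  have := (hI.2.2.2.2.1 f hf _ (memL1_delta t⁻¹)).2
  rwa [convFn_delta_right, inv_inv] at this

/-- A weak*-closed ideal is stable under restriction to a finite FC-centre. -/
lemma IsWStarClosedIdeal.indicator_FC_mem [Finite (FC G)] (hI : IsWStarClosedIdeal I)
    {f : G → ℂ} (hf : f ∈ I) : (FC G : Set G).indicator f ∈ I := by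
  have hfL : MemL1 f := hI.1 hf
  choose s hs_fix hs_move using exists_conj_notMem (G := G)
  refine WStarClosed.mem_of_tendsto (l := atTop) hI.2.2.2.2.2 hI.1
    (u := fun F x => f ((s F)⁻¹ * (x * s F)))
    (fun F => hI.comp_mul_right_mem (hI.comp_mul_left_mem hf (s F)⁻¹) (s F))
    (hfL.indicator _) fun φ hφ => ?_
  obtain ⟨C, hC⟩ := hφ.exists_norm_le
  have hconj (F : Finset G) : ∑' x, φ x * f ((s F)⁻¹ * (x * s F)) =
      ∑' y, φ (s F * y * (s F)⁻¹) * f y := by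
    rw [← (MulAut.conj (s F)).toEquiv.tsum_eq]
    simp [mul_assoc]
  simp only [hconj]
  refine tendsto_tsum_of_dominated_convergence (Summable.mul_left C hfL) (fun y => ?_)
    (Eventually.of_forall fun F y => ?_)
  · by_cases hy : y ∈ FC G
    · simp only [hs_fix _ y hy, Set.indicator_of_mem (SetLike.mem_coe.mpr hy)]
      exact tendsto_const_nhds
    · rw [Set.indicator_of_notMem (by exact hy), mul_zero]
      have hcof : Tendsto (fun F => s F * y * (s F)⁻¹) atTop cofinite := by
        intro E hE
        rw [mem_map]
        filter_upwards [eventually_ge_atTop (insert y (mem_cofinite.mp hE).toFinset)] with F hF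
        by_contra hmem
        exact hs_move F y (hF (Finset.mem_insert_self _ _)) hy
          (hF (Finset.mem_insert_of_mem (by simpa using hmem)))
      simpa using (hφ.comp hcof).mul_const (f y)
  · rw [norm_mul]
    exact mul_le_mul_of_nonneg_right (hC _) (norm_nonneg _)

/-- A function belongs to a weak*-closed ideal if its restrictions to the cosets of a subgroup
do. -/
lemma IsWStarClosedIdeal.mem_of_coset (hI : IsWStarClosedIdeal I) (N : Subgroup G) {f : G → ℂ}
    (hf : MemL1 f)
    (hcoset : ∀ q : G ⧸ N, {x : G | (x : G ⧸ N) = q}.indicator f ∈ I) : f ∈ I := by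
  have hfinset (F : Finset (G ⧸ N)) : {x : G | (x : G ⧸ N) ∈ F}.indicator f ∈ I := by
    induction F using Finset.induction_on with
    | empty =>
      convert hI.2.1 using 1
      ext
      simp
    | insert q F hq ih =>
      convert hI.2.2.1 _ (hcoset q) _ ih using 1
      have hdisj : Disjoint {x : G | (x : G ⧸ N) = q} {x : G | (x : G ⧸ N) ∈ F} :=
        Set.disjoint_left.mpr fun x hx hxF => hq (hx ▸ hxF)
      refine Eq.trans ?_ (Set.indicator_union_of_disjoint hdisj f)
      congr 1
      ext x
      simp
  refine WStarClosed.mem_of_tendsto (l := atTop) hI.2.2.2.2.2 hI.1 hfinset hf fun φ hφ => ?_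
  obtain ⟨C, hC⟩ := hφ.exists_norm_le
  refine tendsto_tsum_of_dominated_convergence (Summable.mul_left C hf) (fun y => ?_)
    (Eventually.of_forall fun F y => ?_)
  · refine tendsto_const_nhds.congr' ?_
    filter_upwards [eventually_ge_atTop {(y : G ⧸ N)}] with F hF
    rw [Set.indicator_of_mem (by exact hF (Finset.mem_singleton_self _))]
  · rw [norm_mul]
    exact mul_le_mul (hC y) (norm_indicator_le_norm_self f y) (norm_nonneg _)
      ((norm_nonneg _).trans (hC y))

/-- The representations of the FC-centre which annihilate the members of `I` supported there. -/
def hull (I : Set (G → ℂ)) : Set (IrrRep (FC G)) :=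
  {π | ∀ f ∈ I, SuppIn (FC G : Set G) f →
    ∑ᶠ n : FC G, f (n : G) • (π.ρ n : Matrix (Fin π.dim) (Fin π.dim) ℂ) = 0}

lemma IsWStarClosedIdeal.conjRep_mem_hull (hI : IsWStarClosedIdeal I) {π : IrrRep (FC G)}
    (hπ : π ∈ hull I) (t : G) : conjRep t π ∈ hull I := by
  intro f hf hsupp
  have hconj : (fun x => f (t * (x * t⁻¹))) ∈ I :=
    hI.comp_mul_right_mem (hI.comp_mul_left_mem hf t) t⁻¹
  refine Eq.trans ?_ (hπ _ hconj fun x hx => hsupp _ fun h => hx ?_)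
  · refine (finsum_comp_equiv (MulAut.conjNormal (G := G) t).toEquiv).symm.trans
      (finsum_congr fun n => ?_)
    have hρ : (conjRep t π).ρ (MulAut.conjNormal t n) = π.ρ n :=
      congrArg π.ρ (Subtype.ext (by simp))
    change f (MulAut.conjNormal t n : FC G) • ((conjRep t π).ρ (MulAut.conjNormal t n)).1 = _
    rw [hρ, MulAut.conjNormal_apply, mul_assoc]
    rfl
  · have := (FC_normal G).conj_mem _ h t⁻¹
    simpa [mul_assoc] using this

/-- The kernel of the hull of a weak*-closed ideal is contained in the ideal. -/
lemma IsWStarClosedIdeal.KSet_hull_subset [Fintype (FC G)] (hI : IsWStarClosedIdeal I) :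
    KSet (hull I) ⊆ I := by
  rintro f ⟨⟨-, hsupp⟩, hf⟩
  let extend : (FC G → ℂ) → G → ℂ := fun v x => if h : x ∈ FC G then v ⟨x, h⟩ else 0
  have eq_extend {g : G → ℂ} (hg : SuppIn (FC G : Set G) g) : g = extend fun n => g n := by
    funext x
    by_cases hx : x ∈ FC G
    · simp [extend, hx]
    · simp [extend, hx, hg x hx]
  let J : Submodule ℂ (FC G → ℂ) :=
    { carrier := {v | extend v ∈ I}
      zero_mem' := by
        change extend 0 ∈ I
        convert hI.2.1 using 1
        funext x
        simp [extend]
      add_mem' := fun {v w} hv hw => by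
        change extend (v + w) ∈ I
        convert hI.2.2.1 _ hv _ hw using 1
        funext x
        by_cases hx : x ∈ FC G <;> simp [extend, hx]
      smul_mem' := fun c v hv => by
        change extend (c • v) ∈ I
        convert hI.2.2.2.1 c _ hv using 1
        funext x
        by_cases hx : x ∈ FC G <;> simp [extend, hx] }
  have hJ (v : FC G → ℂ) : v ∈ J ↔ extend v ∈ I := Iff.rfl
  suffices h : (fun n : FC G => f n) ∈ J by
    rw [eq_extend hsupp]
    exact h
  refine mem_of_forall_irrRep J (fun n v hv => ?_) (fun n v hv => ?_) _ fun π hπ => ?_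
  · rw [hJ] at hv ⊢
    convert hI.comp_mul_left_mem hv n using 1
    funext x
    by_cases hx : x ∈ FC G
    · simp only [extend, dif_pos hx, dif_pos ((FC G).mul_mem n.2 hx)]
      rfl
    · simp [extend, hx, (FC G).mul_mem_cancel_left n.2]
  · rw [hJ] at hv ⊢
    convert hI.comp_mul_right_mem hv n using 1
    funext x
    by_cases hx : x ∈ FC G
    · simp only [extend, dif_pos hx, dif_pos ((FC G).mul_mem hx n.2)]
      rfl
    · simp [extend, hx, (FC G).mul_mem_cancel_right n.2]
  · rw [← finsum_eq_sum_of_fintype]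
    refine hf π fun g hg hgsupp => ?_
    rw [finsum_eq_sum_of_fintype]
    exact hπ (fun n => g n) ((eq_extend hgsupp).subst (motive := (· ∈ I)) hg)

lemma IsWStarClosedIdeal.eq_bigOplus [Fintype (FC G)] (hI : IsWStarClosedIdeal I) {T : Set G}
    (hT : IsTransversal (FC G : Set G) T) :
    I = bigOplus (FC G : Set G) T (KSet (hull I)) := by
  refine Set.Subset.antisymm (fun f hf => ⟨hI.1 hf, fun t _ => ?_⟩) fun f ⟨hfL, hf⟩ => ?_
  · have hmem := hI.indicator_FC_mem (hI.2.2.2.2.1 f hf _ (memL1_delta t⁻¹)).1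
    have hsupp : SuppIn (FC G : Set G)
        ((FC G : Set G).indicator (convFn (delta t⁻¹) f)) :=
      fun x hx => Set.indicator_of_notMem hx _
    exact ⟨⟨hI.1 hmem, hsupp⟩, fun π hπ => hπ _ hmem hsupp⟩
  · refine hI.mem_of_coset (FC G) hfL fun q => ?_
    induction q using QuotientGroup.induction_on with
    | H g =>
    obtain ⟨t, ⟨ht, htg⟩, -⟩ := hT g
    convert hI.comp_mul_left_mem (hI.KSet_hull_subset (hf t ht)) t⁻¹ using 1
    have hqt : (g : G ⧸ FC G) = t := (QuotientGroup.eq.mpr htg).symm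
    funext x
    have hx : (x : G ⧸ FC G) = g ↔ t⁻¹ * x ∈ FC G := by
      rw [hqt, eq_comm, QuotientGroup.eq]
    simp [Set.indicator_apply, hx, convFn_delta_left]

end Ideals

/-- **Theorem 3.** Suppose `FC(G)` is finite and let `T` be a transversal for `FC(G)`
in `G`. The weak*-closed two-sided ideals of `ℓ¹(G)` are exactly the sets
`⊕_{t∈T} δ_t * K(Ω)`, where `Ω` ranges over the subsets of the unitary dual of `FC(G)`
that are unions of orbits for the conjugation action of `G`. -/
theorem weakStarClosed_ideals_of_ell1_finite_FC (G : Type*) [Group G]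
    (hfin : (FC G : Set G).Finite) (T : Set G)
    (hT : IsTransversal (FC G : Set G) T) (I : Set (G → ℂ)) :
    IsWStarClosedIdeal I ↔
      ∃ Ω : Set (IrrRep (FC G)),
        (∀ π ∈ Ω, ∀ t : G, conjRep t π ∈ Ω) ∧
        I = bigOplus (FC G : Set G) T (KSet Ω) := by
  have : Fintype (FC G) := hfin.fintype
  constructor
  · exact fun hI => ⟨hull I, fun π hπ t => hI.conjRep_mem_hull hπ t, hI.eq_bigOplus hT⟩
  · rintro ⟨Ω, hΩ, rfl⟩
    exact isWStarClosedIdeal_bigOplus hT hΩ
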